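/- At every point (z₁,z₂) of the ellipsoid {u = 0} (where h > 0 holds automatically), one has −(1/h)·Z₁̄Z₁(log h) + 2i·(c₁·Tu₂ − c₂·Tu₁) + (c₂·Z₁̄Z₁u₁ − c₁·Z₁̄Z₁u₂)/h = |Z₁h|²/h³ + (2b₁(b₂² − 2a₂²)·|u₁|² + 2b₂(b₁² − 2a₁²)·|u₂|²)/h², and this common value is strictly positive. (The left-hand side is the Webster curvature R of the ellipsoid; hence every ellipsoid in ℂ² has positive Webster curvature.) -/

import Mathlib

open Complex ComplexConjugate

noncomputable section

/-- Wirtinger derivative `∂f/∂z₁ = (1/2)(∂f/∂x₁ − i·∂f/∂y₁)`. -/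
def dz1 (f : ℂ × ℂ → ℂ) (p : ℂ × ℂ) : ℂ :=
  (1 / 2) * (fderiv ℝ f p (1, 0) - Complex.I * fderiv ℝ f p (Complex.I, 0))

/-- Wirtinger derivative `∂f/∂z₂ = (1/2)(∂f/∂x₂ − i·∂f/∂y₂)`. -/
def dz2 (f : ℂ × ℂ → ℂ) (p : ℂ × ℂ) : ℂ :=
  (1 / 2) * (fderiv ℝ f p (0, 1) - Complex.I * fderiv ℝ f p (0, Complex.I))

/-- Wirtinger derivative `∂f/∂z̄₁ = (1/2)(∂f/∂x₁ + i·∂f/∂y₁)`. -/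
def dzbar1 (f : ℂ × ℂ → ℂ) (p : ℂ × ℂ) : ℂ :=
  (1 / 2) * (fderiv ℝ f p (1, 0) + Complex.I * fderiv ℝ f p (Complex.I, 0))

/-- Wirtinger derivative `∂f/∂z̄₂ = (1/2)(∂f/∂x₂ + i·∂f/∂y₂)`. -/
def dzbar2 (f : ℂ × ℂ → ℂ) (p : ℂ × ℂ) : ℂ :=
  (1 / 2) * (fderiv ℝ f p (0, 1) + Complex.I * fderiv ℝ f p (0, Complex.I))

/-- The ellipsoid defining function
`u(z₁,z₂) = b₁|z₁|² + b₂|z₂|² + 2a₁Re(z₁²) + 2a₂Re(z₂²) − 1`. -/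
def uDef (a₁ a₂ b₁ b₂ : ℝ) (p : ℂ × ℂ) : ℝ :=
  b₁ * Complex.normSq p.1 + b₂ * Complex.normSq p.2
    + 2 * a₁ * (p.1 ^ 2).re + 2 * a₂ * (p.2 ^ 2).re - 1

/-- `u₁ = ∂u/∂z₁ = b₁·conj z₁ + 2a₁z₁`. -/
def u1 (a₁ b₁ : ℝ) (p : ℂ × ℂ) : ℂ := b₁ * conj p.1 + 2 * a₁ * p.1

/-- `u₂ = ∂u/∂z₂ = b₂·conj z₂ + 2a₂z₂`. -/
def u2 (a₂ b₂ : ℝ) (p : ℂ × ℂ) : ℂ := b₂ * conj p.2 + 2 * a₂ * p.2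

/-- The Levi form `h = b₁|u₂|² + b₂|u₁|²` of the ellipsoid. -/
def hLevi (a₁ a₂ b₁ b₂ : ℝ) (p : ℂ × ℂ) : ℝ :=
  b₁ * Complex.normSq (u2 a₂ b₂ p) + b₂ * Complex.normSq (u1 a₁ b₁ p)

/-- The CR vector field `Z₁f = u₂·∂f/∂z₁ − u₁·∂f/∂z₂`. -/
def Z1 (a₁ a₂ b₁ b₂ : ℝ) (f : ℂ × ℂ → ℂ) (p : ℂ × ℂ) : ℂ :=
  u2 a₂ b₂ p * dz1 f p - u1 a₁ b₁ p * dz2 f p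

/-- The conjugate CR vector field `Z₁̄f = conj(u₂)·∂f/∂z̄₁ − conj(u₁)·∂f/∂z̄₂`. -/
def Zbar1 (a₁ a₂ b₁ b₂ : ℝ) (f : ℂ × ℂ → ℂ) (p : ℂ × ℂ) : ℂ :=
  conj (u2 a₂ b₂ p) * dzbar1 f p - conj (u1 a₁ b₁ p) * dzbar2 f p

/-- The characteristic vector field
`Tf = (i/h)(b₂·conj(u₁)·∂f/∂z₁ + b₁·conj(u₂)·∂f/∂z₂) − (i/h)(b₂·u₁·∂f/∂z̄₁ + b₁·u₂·∂f/∂z̄₂)`. -/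
def Tchar (a₁ a₂ b₁ b₂ : ℝ) (f : ℂ × ℂ → ℂ) (p : ℂ × ℂ) : ℂ :=
  (Complex.I / (hLevi a₁ a₂ b₁ b₂ p : ℂ)) *
      ((b₂ : ℂ) * conj (u1 a₁ b₁ p) * dz1 f p + (b₁ : ℂ) * conj (u2 a₂ b₂ p) * dz2 f p)
    - (Complex.I / (hLevi a₁ a₂ b₁ b₂ p : ℂ)) *
      ((b₂ : ℂ) * u1 a₁ b₁ p * dzbar1 f p + (b₁ : ℂ) * u2 a₂ b₂ p * dzbar2 f p)

/-- `c₁ = b₁·conj(u₂)/h`. -/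
def c1 (a₁ a₂ b₁ b₂ : ℝ) (p : ℂ × ℂ) : ℂ :=
  (b₁ : ℂ) * conj (u2 a₂ b₂ p) / (hLevi a₁ a₂ b₁ b₂ p : ℂ)

/-- `c₂ = −b₂·conj(u₁)/h`. -/
def c2 (a₁ a₂ b₁ b₂ : ℝ) (p : ℂ × ℂ) : ℂ :=
  -((b₂ : ℂ) * conj (u1 a₁ b₁ p)) / (hLevi a₁ a₂ b₁ b₂ p : ℂ)

/-- The real-linear form `d₁ dz₁ + d₂ dz₂ + e₁ dz̄₁ + e₂ dz̄₂` on `ℂ × ℂ`. -/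
def wirtingerForm (d₁ d₂ e₁ e₂ : ℂ) : ℂ × ℂ →L[ℝ] ℂ :=
  d₁ • ContinuousLinearMap.fst ℝ ℂ ℂ + d₂ • ContinuousLinearMap.snd ℝ ℂ ℂ
    + e₁ • (conjCLE : ℂ →L[ℝ] ℂ).comp (ContinuousLinearMap.fst ℝ ℂ ℂ)
    + e₂ • (conjCLE : ℂ →L[ℝ] ℂ).comp (ContinuousLinearMap.snd ℝ ℂ ℂ)

theorem wirtingerForm_apply (d₁ d₂ e₁ e₂ : ℂ) (v : ℂ × ℂ) :
    wirtingerForm d₁ d₂ e₁ e₂ v = d₁ * v.1 + d₂ * v.2 + e₁ * conj v.1 + e₂ * conj v.2 := by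
  simp [wirtingerForm]

/-- `f` is real-differentiable at `p` with Wirtinger derivatives `∂f/∂z₁ = d₁`, `∂f/∂z₂ = d₂`,
`∂f/∂z̄₁ = e₁`, `∂f/∂z̄₂ = e₂`. -/
def HasWirtingerAt (f : ℂ × ℂ → ℂ) (d₁ d₂ e₁ e₂ : ℂ) (p : ℂ × ℂ) : Prop :=
  HasFDerivAt f (wirtingerForm d₁ d₂ e₁ e₂) p

namespace HasWirtingerAt

variable {f g : ℂ × ℂ → ℂ} {d₁ d₂ e₁ e₂ d₁' d₂' e₁' e₂' : ℂ} {p : ℂ × ℂ}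

theorem dz1_eq (hf : HasWirtingerAt f d₁ d₂ e₁ e₂ p) : dz1 f p = d₁ := by
  simp only [dz1, HasFDerivAt.fderiv hf, wirtingerForm_apply, map_one, map_zero, conj_I]
  linear_combination (-(1 / 2) * d₁ + (1 / 2) * e₁) * I_mul_I

theorem dz2_eq (hf : HasWirtingerAt f d₁ d₂ e₁ e₂ p) : dz2 f p = d₂ := by
  simp only [dz2, HasFDerivAt.fderiv hf, wirtingerForm_apply, map_one, map_zero, conj_I]
  linear_combination (-(1 / 2) * d₂ + (1 / 2) * e₂) * I_mul_I

theorem dzbar1_eq (hf : HasWirtingerAt f d₁ d₂ e₁ e₂ p) : dzbar1 f p = e₁ := by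
  simp only [dzbar1, HasFDerivAt.fderiv hf, wirtingerForm_apply, map_one, map_zero, conj_I]
  linear_combination ((1 / 2) * d₁ - (1 / 2) * e₁) * I_mul_I

theorem dzbar2_eq (hf : HasWirtingerAt f d₁ d₂ e₁ e₂ p) : dzbar2 f p = e₂ := by
  simp only [dzbar2, HasFDerivAt.fderiv hf, wirtingerForm_apply, map_one, map_zero, conj_I]
  linear_combination ((1 / 2) * d₂ - (1 / 2) * e₂) * I_mul_I

theorem congr_of_eventuallyEq (hf : HasWirtingerAt f d₁ d₂ e₁ e₂ p) (h : g =ᶠ[nhds p] f) :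
    HasWirtingerAt g d₁ d₂ e₁ e₂ p :=
  HasFDerivAt.congr_of_eventuallyEq hf h

theorem add (hf : HasWirtingerAt f d₁ d₂ e₁ e₂ p) (hg : HasWirtingerAt g d₁' d₂' e₁' e₂' p) :
    HasWirtingerAt (fun q => f q + g q) (d₁ + d₁') (d₂ + d₂') (e₁ + e₁') (e₂ + e₂') p := by
  refine (HasFDerivAt.add hf hg).congr_fderiv (ContinuousLinearMap.ext fun v => ?_)
  simp only [add_apply, wirtingerForm_apply]
  ring

theorem mul (hf : HasWirtingerAt f d₁ d₂ e₁ e₂ p) (hg : HasWirtingerAt g d₁' d₂' e₁' e₂' p) :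
    HasWirtingerAt (fun q => f q * g q) (f p * d₁' + g p * d₁) (f p * d₂' + g p * d₂)
      (f p * e₁' + g p * e₁) (f p * e₂' + g p * e₂) p := by
  refine (HasFDerivAt.mul hf hg).congr_fderiv (ContinuousLinearMap.ext fun v => ?_)
  simp only [add_apply, smul_apply, smul_eq_mul,
    wirtingerForm_apply]
  ring

theorem const_mul (c : ℂ) (hf : HasWirtingerAt f d₁ d₂ e₁ e₂ p) :
    HasWirtingerAt (fun q => c * f q) (c * d₁) (c * d₂) (c * e₁) (c * e₂) p := by
  refine (HasFDerivAt.const_mul hf c).congr_fderiv (ContinuousLinearMap.ext fun v => ?_)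
  simp only [smul_apply, smul_eq_mul, wirtingerForm_apply]
  ring

/-- Chain rule for a holomorphic outer function. -/
theorem comp_holomorphic {φ : ℂ → ℂ} {φ' : ℂ} (hφ : HasDerivAt φ φ' (f p))
    (hf : HasWirtingerAt f d₁ d₂ e₁ e₂ p) :
    HasWirtingerAt (fun q => φ (f q)) (φ' * d₁) (φ' * d₂) (φ' * e₁) (φ' * e₂) p := by
  refine ((hφ.hasFDerivAt.restrictScalars ℝ).comp p hf).congr_fderiv
    (ContinuousLinearMap.ext fun v => ?_)
  simp [wirtingerForm_apply]
  ring

/-- Wirtinger derivatives of the complex conjugate. -/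
theorem star (hf : HasWirtingerAt f d₁ d₂ e₁ e₂ p) :
    HasWirtingerAt (fun q => conj (f q)) (conj e₁) (conj e₂) (conj d₁) (conj d₂) p := by
  refine ((conjCLE : ℂ →L[ℝ] ℂ).hasFDerivAt.comp p hf).congr_fderiv
    (ContinuousLinearMap.ext fun v => ?_)
  simp [wirtingerForm_apply]
  ring

theorem Z1_eq (hf : HasWirtingerAt f d₁ d₂ e₁ e₂ p) (a₁ a₂ b₁ b₂ : ℝ) :
    Z1 a₁ a₂ b₁ b₂ f p = u2 a₂ b₂ p * d₁ - u1 a₁ b₁ p * d₂ := by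
  rw [Z1, hf.dz1_eq, hf.dz2_eq]

theorem Zbar1_eq (hf : HasWirtingerAt f d₁ d₂ e₁ e₂ p) (a₁ a₂ b₁ b₂ : ℝ) :
    Zbar1 a₁ a₂ b₁ b₂ f p = conj (u2 a₂ b₂ p) * e₁ - conj (u1 a₁ b₁ p) * e₂ := by
  rw [Zbar1, hf.dzbar1_eq, hf.dzbar2_eq]

end HasWirtingerAt

theorem hasWirtingerAt_u1 (a b : ℝ) (p : ℂ × ℂ) :
    HasWirtingerAt (u1 a b) (2 * a) 0 b 0 p := by
  refine HasFDerivAt.congr_of_eventuallyEq (wirtingerForm (2 * a) 0 b 0).hasFDerivAt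
    (Filter.Eventually.of_forall fun q => ?_)
  simp only [u1, wirtingerForm_apply]
  ring

theorem hasWirtingerAt_u2 (a b : ℝ) (p : ℂ × ℂ) :
    HasWirtingerAt (u2 a b) 0 (2 * a) 0 b p := by
  refine HasFDerivAt.congr_of_eventuallyEq (wirtingerForm 0 (2 * a) 0 b).hasFDerivAt
    (Filter.Eventually.of_forall fun q => ?_)
  simp only [u2, wirtingerForm_apply]
  ring

theorem ofReal_hLevi (a₁ a₂ b₁ b₂ : ℝ) (p : ℂ × ℂ) :
    (hLevi a₁ a₂ b₁ b₂ p : ℂ) =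
      b₁ * (u2 a₂ b₂ p * conj (u2 a₂ b₂ p)) + b₂ * (u1 a₁ b₁ p * conj (u1 a₁ b₁ p)) := by
  simp only [hLevi, mul_conj]
  push_cast
  ring

theorem hasWirtingerAt_hLevi (a₁ a₂ b₁ b₂ : ℝ) (p : ℂ × ℂ) :
    HasWirtingerAt (fun q => (hLevi a₁ a₂ b₁ b₂ q : ℂ))
      (b₂ * (b₁ * u1 a₁ b₁ p + 2 * a₁ * conj (u1 a₁ b₁ p)))
      (b₁ * (b₂ * u2 a₂ b₂ p + 2 * a₂ * conj (u2 a₂ b₂ p)))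
      (b₂ * (2 * a₁ * u1 a₁ b₁ p + b₁ * conj (u1 a₁ b₁ p)))
      (b₁ * (2 * a₂ * u2 a₂ b₂ p + b₂ * conj (u2 a₂ b₂ p))) p := by
  have hu₁ := hasWirtingerAt_u1 a₁ b₁ p
  have hu₂ := hasWirtingerAt_u2 a₂ b₂ p
  convert ((hu₂.mul hu₂.star).const_mul b₁).add ((hu₁.mul hu₁.star).const_mul b₂) using 1
  · exact funext fun q => ofReal_hLevi a₁ a₂ b₁ b₂ q
  all_goals
    simp only [map_mul, map_zero, map_ofNat, conj_ofReal]
    ring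

theorem eventually_hLevi_pos {a₁ a₂ b₁ b₂ : ℝ} {p : ℂ × ℂ} (hp : 0 < hLevi a₁ a₂ b₁ b₂ p) :
    ∀ᶠ q in nhds p, 0 < hLevi a₁ a₂ b₁ b₂ q := by
  have hcont : Continuous (hLevi a₁ a₂ b₁ b₂) := by
    unfold hLevi u1 u2
    fun_prop
  exact hcont.continuousAt.eventually (lt_mem_nhds hp)

theorem Z1_u1 (a₁ a₂ b₁ b₂ : ℝ) :
    Z1 a₁ a₂ b₁ b₂ (u1 a₁ b₁) = fun q => 2 * a₁ * u2 a₂ b₂ q := by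
  funext q
  rw [(hasWirtingerAt_u1 a₁ b₁ q).Z1_eq]
  ring

theorem Z1_u2 (a₁ a₂ b₁ b₂ : ℝ) :
    Z1 a₁ a₂ b₁ b₂ (u2 a₂ b₂) = fun q => -(2 * a₂) * u1 a₁ b₁ q := by
  funext q
  rw [(hasWirtingerAt_u2 a₂ b₂ q).Z1_eq]
  ring

theorem Z1_hLevi (a₁ a₂ b₁ b₂ : ℝ) (p : ℂ × ℂ) :
    Z1 a₁ a₂ b₁ b₂ (fun q => (hLevi a₁ a₂ b₁ b₂ q : ℂ)) p =
      2 * a₁ * b₂ * (u2 a₂ b₂ p * conj (u1 a₁ b₁ p))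
        + -(2 * a₂ * b₁) * (u1 a₁ b₁ p * conj (u2 a₂ b₂ p)) := by
  rw [(hasWirtingerAt_hLevi a₁ a₂ b₁ b₂ p).Z1_eq]
  ring

theorem Z1_log_hLevi {a₁ a₂ b₁ b₂ : ℝ} {p : ℂ × ℂ} (hp : 0 < hLevi a₁ a₂ b₁ b₂ p) :
    Z1 a₁ a₂ b₁ b₂ (fun q => (Real.log (hLevi a₁ a₂ b₁ b₂ q) : ℂ)) p =
      (hLevi a₁ a₂ b₁ b₂ p : ℂ)⁻¹ *
        Z1 a₁ a₂ b₁ b₂ (fun q => (hLevi a₁ a₂ b₁ b₂ q : ℂ)) p := by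
  have hh := hasWirtingerAt_hLevi a₁ a₂ b₁ b₂ p
  have hlog := hh.comp_holomorphic (hasDerivAt_log (ofReal_mem_slitPlane.2 hp))
  have heq : (fun q => (Real.log (hLevi a₁ a₂ b₁ b₂ q) : ℂ)) =ᶠ[nhds p]
      fun q => log (hLevi a₁ a₂ b₁ b₂ q : ℂ) := by
    filter_upwards [eventually_hLevi_pos hp] with q hq
    exact ofReal_log hq.le
  rw [(hlog.congr_of_eventuallyEq heq).Z1_eq, hh.Z1_eq]
  ring

theorem Zbar1_Z1_log_hLevi {a₁ a₂ b₁ b₂ : ℝ} {p : ℂ × ℂ} (hp : 0 < hLevi a₁ a₂ b₁ b₂ p) :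
    Zbar1 a₁ a₂ b₁ b₂
        (Z1 a₁ a₂ b₁ b₂ (fun q => (Real.log (hLevi a₁ a₂ b₁ b₂ q) : ℂ))) p =
      (4 * a₂ ^ 2 * b₁ * (u1 a₁ b₁ p * conj (u1 a₁ b₁ p))
          + 4 * a₁ ^ 2 * b₂ * (u2 a₂ b₂ p * conj (u2 a₂ b₂ p))
          - 2 * a₂ * b₁ ^ 2 * conj (u2 a₂ b₂ p) ^ 2
          - 2 * a₁ * b₂ ^ 2 * conj (u1 a₁ b₁ p) ^ 2) / hLevi a₁ a₂ b₁ b₂ p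
        - normSq (Z1 a₁ a₂ b₁ b₂ (fun q => (hLevi a₁ a₂ b₁ b₂ q : ℂ)) p)
          / (hLevi a₁ a₂ b₁ b₂ p : ℂ) ^ 2 := by
  have hu₁ := hasWirtingerAt_u1 a₁ b₁ p
  have hu₂ := hasWirtingerAt_u2 a₂ b₂ p
  have hh := hasWirtingerAt_hLevi a₁ a₂ b₁ b₂ p
  have hne : (hLevi a₁ a₂ b₁ b₂ p : ℂ) ≠ 0 := ofReal_ne_zero.2 hp.ne'
  have hZ := (hh.comp_holomorphic (hasDerivAt_inv hne)).mul
    (((hu₂.mul hu₁.star).const_mul (2 * a₁ * b₂)).add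
      ((hu₁.mul hu₂.star).const_mul (-(2 * a₂ * b₁))))
  have heq : Z1 a₁ a₂ b₁ b₂ (fun q => (Real.log (hLevi a₁ a₂ b₁ b₂ q) : ℂ)) =ᶠ[nhds p]
      fun q => (hLevi a₁ a₂ b₁ b₂ q : ℂ)⁻¹ *
        (2 * a₁ * b₂ * (u2 a₂ b₂ q * conj (u1 a₁ b₁ q))
          + -(2 * a₂ * b₁) * (u1 a₁ b₁ q * conj (u2 a₂ b₂ q))) := by
    filter_upwards [eventually_hLevi_pos hp] with q hq
    rw [Z1_log_hLevi hq, Z1_hLevi]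
  rw [(hZ.congr_of_eventuallyEq heq).Zbar1_eq, ← mul_conj, Z1_hLevi]
  simp only [map_add, map_neg, map_mul, map_zero, map_ofNat, conj_ofReal, conj_conj]
  field_simp
  ring

/-- The Webster curvature formula, valid wherever the Levi form is positive. -/
theorem webster_curvature_eq {a₁ a₂ b₁ b₂ : ℝ} {p : ℂ × ℂ} (hp : 0 < hLevi a₁ a₂ b₁ b₂ p) :
    -(1 / (hLevi a₁ a₂ b₁ b₂ p : ℂ)) * Zbar1 a₁ a₂ b₁ b₂
          (Z1 a₁ a₂ b₁ b₂ (fun q => (Real.log (hLevi a₁ a₂ b₁ b₂ q) : ℂ))) p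
        + 2 * Complex.I *
          (c1 a₁ a₂ b₁ b₂ p * Tchar a₁ a₂ b₁ b₂ (u2 a₂ b₂) p
            - c2 a₁ a₂ b₁ b₂ p * Tchar a₁ a₂ b₁ b₂ (u1 a₁ b₁) p)
        + (c2 a₁ a₂ b₁ b₂ p * Zbar1 a₁ a₂ b₁ b₂ (Z1 a₁ a₂ b₁ b₂ (u1 a₁ b₁)) p
            - c1 a₁ a₂ b₁ b₂ p * Zbar1 a₁ a₂ b₁ b₂ (Z1 a₁ a₂ b₁ b₂ (u2 a₂ b₂)) p)
          / (hLevi a₁ a₂ b₁ b₂ p : ℂ)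
      = ((normSq (Z1 a₁ a₂ b₁ b₂ (fun q => (hLevi a₁ a₂ b₁ b₂ q : ℂ)) p)
            / hLevi a₁ a₂ b₁ b₂ p ^ 3
          + (2 * b₁ * (b₂ ^ 2 - 2 * a₂ ^ 2) * normSq (u1 a₁ b₁ p)
              + 2 * b₂ * (b₁ ^ 2 - 2 * a₁ ^ 2) * normSq (u2 a₂ b₂ p))
            / hLevi a₁ a₂ b₁ b₂ p ^ 2 : ℝ) : ℂ) := by
  have hu₁ := hasWirtingerAt_u1 a₁ b₁ p
  have hu₂ := hasWirtingerAt_u2 a₂ b₂ p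
  have hne : (hLevi a₁ a₂ b₁ b₂ p : ℂ) ≠ 0 := ofReal_ne_zero.2 hp.ne'
  rw [Zbar1_Z1_log_hLevi hp, Z1_u1, Z1_u2, (hu₂.const_mul _).Zbar1_eq, (hu₁.const_mul _).Zbar1_eq]
  simp only [Tchar, c1, c2, hu₁.dz1_eq, hu₁.dz2_eq, hu₁.dzbar1_eq, hu₁.dzbar2_eq,
    hu₂.dz1_eq, hu₂.dz2_eq, hu₂.dzbar1_eq, hu₂.dzbar2_eq]
  push_cast
  simp only [← mul_conj (u1 a₁ b₁ p), ← mul_conj (u2 a₂ b₂ p)]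
  generalize (normSq (Z1 a₁ a₂ b₁ b₂ (fun q => (hLevi a₁ a₂ b₁ b₂ q : ℂ)) p) : ℂ) = N
  generalize (hLevi a₁ a₂ b₁ b₂ p : ℂ) = h at hne ⊢
  field_simp
  simp only [I_sq]
  ring

theorem normSq_conj_add (a b : ℝ) (z : ℂ) :
    normSq (b * conj z + 2 * a * z) = (b + 2 * a) ^ 2 * z.re ^ 2 + (b - 2 * a) ^ 2 * z.im ^ 2 := by
  simp [normSq_apply]
  ring

theorem normSq_conj_add_pos {a b : ℝ} (h₁ : 0 < b + 2 * a) (h₂ : 0 < b - 2 * a) {z : ℂ}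
    (hz : z ≠ 0) : 0 < normSq (b * conj z + 2 * a * z) := by
  rw [normSq_conj_add]
  by_cases hre : z.re = 0
  · have him : z.im ≠ 0 := fun him => hz (Complex.ext hre him)
    positivity
  · positivity

/-- Positivity of the Webster curvature of the ellipsoid: at every point of `{u = 0}`
one has `h > 0`, the Webster curvature
`R = −(1/h)Z₁̄Z₁(log h) + 2i(c₁Tu₂ − c₂Tu₁) + (c₂Z₁̄Z₁u₁ − c₁Z₁̄Z₁u₂)/h`
equals `|Z₁h|²/h³ + (2b₁(b₂² − 2a₂²)|u₁|² + 2b₂(b₁² − 2a₁²)|u₂|²)/h²`,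
and this common value is strictly positive. -/
theorem ellipsoid_webster_curvature_positive
    (A₁ B₁ A₂ B₂ a₁ a₂ b₁ b₂ : ℝ)
    (hA₁ : 0 < A₁) (hB₁ : 0 < B₁) (hA₂ : 0 < A₂) (hB₂ : 0 < B₂)
    (ha₁ : a₁ = (A₁ - B₁) / 4) (ha₂ : a₂ = (A₂ - B₂) / 4)
    (hb₁ : b₁ = (A₁ + B₁) / 2) (hb₂ : b₂ = (A₂ + B₂) / 2)
    (hC : ℂ × ℂ → ℂ) (hhC : hC = fun q => ((hLevi a₁ a₂ b₁ b₂ q : ℝ) : ℂ))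
    (logH : ℂ × ℂ → ℂ)
    (hlogH : logH = fun q => ((Real.log (hLevi a₁ a₂ b₁ b₂ q) : ℝ) : ℂ)) :
    ∀ p : ℂ × ℂ, uDef a₁ a₂ b₁ b₂ p = 0 →
      0 < hLevi a₁ a₂ b₁ b₂ p ∧
      -(1 / (hLevi a₁ a₂ b₁ b₂ p : ℂ)) * Zbar1 a₁ a₂ b₁ b₂ (Z1 a₁ a₂ b₁ b₂ logH) p
          + 2 * Complex.I *
            (c1 a₁ a₂ b₁ b₂ p * Tchar a₁ a₂ b₁ b₂ (u2 a₂ b₂) p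
              - c2 a₁ a₂ b₁ b₂ p * Tchar a₁ a₂ b₁ b₂ (u1 a₁ b₁) p)
          + (c2 a₁ a₂ b₁ b₂ p * Zbar1 a₁ a₂ b₁ b₂ (Z1 a₁ a₂ b₁ b₂ (u1 a₁ b₁)) p
              - c1 a₁ a₂ b₁ b₂ p * Zbar1 a₁ a₂ b₁ b₂ (Z1 a₁ a₂ b₁ b₂ (u2 a₂ b₂)) p)
            / (hLevi a₁ a₂ b₁ b₂ p : ℂ)
        = ((Complex.normSq (Z1 a₁ a₂ b₁ b₂ hC p) / hLevi a₁ a₂ b₁ b₂ p ^ 3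
            + (2 * b₁ * (b₂ ^ 2 - 2 * a₂ ^ 2) * Complex.normSq (u1 a₁ b₁ p)
                + 2 * b₂ * (b₁ ^ 2 - 2 * a₁ ^ 2) * Complex.normSq (u2 a₂ b₂ p))
              / hLevi a₁ a₂ b₁ b₂ p ^ 2 : ℝ) : ℂ) ∧
      0 < Complex.normSq (Z1 a₁ a₂ b₁ b₂ hC p) / hLevi a₁ a₂ b₁ b₂ p ^ 3
            + (2 * b₁ * (b₂ ^ 2 - 2 * a₂ ^ 2) * Complex.normSq (u1 a₁ b₁ p)
                + 2 * b₂ * (b₁ ^ 2 - 2 * a₁ ^ 2) * Complex.normSq (u2 a₂ b₂ p))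
              / hLevi a₁ a₂ b₁ b₂ p ^ 2 := by
  intro p hu
  subst hhC hlogH
  have hb₁' : 0 < b₁ := by linarith
  have hb₂' : 0 < b₂ := by linarith
  have hne : p.1 ≠ 0 ∨ p.2 ≠ 0 := by
    by_contra! hp
    simp [uDef, hp.1, hp.2] at hu
  have hsum : 0 < normSq (u1 a₁ b₁ p) ∨ 0 < normSq (u2 a₂ b₂ p) :=
    hne.imp (normSq_conj_add_pos (by linarith) (by linarith))
      (normSq_conj_add_pos (by linarith) (by linarith))
  have hcomb : ∀ s t : ℝ, 0 < s → 0 < t →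
      0 < s * normSq (u1 a₁ b₁ p) + t * normSq (u2 a₂ b₂ p) := by
    intro s t hs ht
    have h₁ := normSq_nonneg (u1 a₁ b₁ p)
    have h₂ := normSq_nonneg (u2 a₂ b₂ p)
    rcases hsum with h | h <;> positivity
  have hpos : 0 < hLevi a₁ a₂ b₁ b₂ p := by
    rw [hLevi, add_comm]
    exact hcomb b₂ b₁ hb₂' hb₁'
  have hq₁ : 0 < b₁ ^ 2 - 2 * a₁ ^ 2 := by
    rw [ha₁, hb₁]
    nlinarith [mul_pos hA₁ hB₁, sq_nonneg (A₁ + B₁)]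
  have hq₂ : 0 < b₂ ^ 2 - 2 * a₂ ^ 2 := by
    rw [ha₂, hb₂]
    nlinarith [mul_pos hA₂ hB₂, sq_nonneg (A₂ + B₂)]
  refine ⟨hpos, webster_curvature_eq hpos, add_pos_of_nonneg_of_pos ?_ (div_pos ?_ (by positivity))⟩
  · exact div_nonneg (normSq_nonneg _) (by positivity)
  · exact hcomb _ _ (by positivity) (by positivity)
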